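/- Let \(\alpha > -1\) with \(\alpha\) not a nonnegative integer, and define \(a_i(x) = \frac{1}{i!}\sum_{j=1}^i(-1)^{i+j+1}\binom{\alpha+1}{j-1}\binom{\alpha+2}{i-j}(\alpha+3)_{i-j}\,x^j\). Then for every real x, the series \(\sum_{i=1}^{\infty} a_i(x)\) converges and equals \(-\frac{\sin(\pi\alpha)}{\pi}\,\frac{x}{(\alpha+2)(\alpha+3)}\sum_{k=0}^{\infty}\frac{(1)_k}{(\alpha+4)_k}\frac{(-x)^k}{k!}\), i.e. \(-\frac{\sin\pi\alpha}{\pi}\frac{x}{(\alpha+2)(\alpha+3)}\,{}_1F_1(1;\alpha+4;-x)\). -/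

import Mathlib

open Finset

/-- Rising factorial (Pochhammer symbol) `(x)_k = x(x+1)⋯(x+k-1)`. -/
noncomputable def poch (x : ℝ) (k : ℕ) : ℝ := (ascPochhammer ℝ k).eval x

/-- Generalized binomial coefficient `C(y, m) = (y-m+1)_m / m!` for real `y`. -/
noncomputable def gbinom (y : ℝ) (m : ℕ) : ℝ := poch (y - m + 1) m / m.factorial

/-- Generalized binomial coefficient with integer lower index, zero for negative index. -/
noncomputable def gbinomZ (y : ℝ) (m : ℤ) : ℝ := if 0 ≤ m then gbinom y m.toNat else 0

/-- Generalized Laguerre polynomial `L_n^{(a)}(x)`, defined for all real `a`. -/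
noncomputable def Lag (n : ℕ) (a : ℝ) (x : ℝ) : ℝ :=
  ∑ k ∈ range (n + 1),
    (-1 : ℝ) ^ k * poch (a + k + 1) (n - k) / (n - k).factorial * x ^ k / k.factorial

/-- The coefficients `a_i(x)` of the differential equation, for parameter `α`. -/
noncomputable def aCoef (α : ℝ) (i : ℕ) (x : ℝ) : ℝ :=
  1 / i.factorial *
    ∑ j ∈ Icc 1 i,
      (-1 : ℝ) ^ (i + j + 1) * gbinom (α + 1) (j - 1) * gbinom (α + 2) (i - j)
        * poch (α + 3) (i - j) * x ^ j

section
open Filter Topology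

lemma poch_zero (x : ℝ) : poch x 0 = 1 := by simp [poch]

lemma poch_succ (x : ℝ) (n : ℕ) : poch x (n + 1) = poch x n * (x + n) := by
  simp [poch, ascPochhammer_succ_eval]

lemma poch_succ_left (x : ℝ) (n : ℕ) : poch x (n + 1) = x * poch (x + 1) n := by
  simp [poch, ascPochhammer_succ_left, Polynomial.eval_comp]

lemma poch_one (n : ℕ) : poch 1 n = n.factorial := by
  simp [poch]

lemma poch_pos {x : ℝ} (hx : 0 < x) (n : ℕ) : 0 < poch x n := ascPochhammer_pos n x hx

lemma poch_reflect (y : ℝ) (n : ℕ) : poch (y - n + 1) n = (-1) ^ n * poch (-y) n := by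
  induction n with
  | zero => simp [poch_zero]
  | succ n ih =>
    rw [poch_succ_left, poch_succ]
    have h : y - ((n + 1 : ℕ) : ℝ) + 1 + 1 = y - n + 1 := by push_cast; ring
    rw [h, ih]
    push_cast
    ring

lemma gbinom_eq_poch_neg (y : ℝ) (n : ℕ) :
    gbinom y n = (-1) ^ n * poch (-y) n / n.factorial := by
  rw [gbinom, poch_reflect]

lemma gbinom_succ (y : ℝ) (n : ℕ) : gbinom y (n + 1) = gbinom y n * ((y - n) / (n + 1)) := by
  rw [gbinom_eq_poch_neg, gbinom_eq_poch_neg, poch_succ, Nat.factorial_succ]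
  push_cast
  field_simp
  ring

lemma abs_gbinom_le (y : ℝ) (n : ℕ) : |gbinom y n| ≤ (|y| + 1) ^ n := by
  induction n with
  | zero => simp [gbinom, poch_zero]
  | succ n ih =>
    rw [gbinom_succ, abs_mul, pow_succ]
    refine mul_le_mul ih ?_ (abs_nonneg _) (by positivity)
    have hn : (0 : ℝ) < n + 1 := by positivity
    rw [abs_div, abs_of_pos hn, div_le_iff₀ hn]
    have h1 : |y - n| ≤ |y| + n := by simpa using abs_sub y (n : ℝ)
    have := mul_nonneg (abs_nonneg y) (Nat.cast_nonneg (α := ℝ) n)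
    nlinarith

/-- The general term of `₂F₁(-s, s + 1; j + 1; 1) / j!`. -/
noncomputable def hypTerm (s : ℝ) (j n : ℕ) : ℝ :=
  poch (-s) n * poch (s + 1) n / (n.factorial * (n + j).factorial)

lemma hypTerm_succ_left (s : ℝ) (j n : ℕ) :
    hypTerm s (j + 1) n = hypTerm s j n / (n + j + 1) := by
  have h : (n : ℝ) + j + 1 ≠ 0 := by positivity
  rw [hypTerm, hypTerm, ← add_assoc, Nat.factorial_succ]
  push_cast
  field_simp

lemma hypTerm_succ_right (s : ℝ) (j n : ℕ) :
    hypTerm s j (n + 1) = hypTerm s j n * ((n - s) * (n + s + 1) / ((n + 1) * (n + j + 1))) := by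
  have h : (n : ℝ) + j + 1 ≠ 0 := by positivity
  rw [hypTerm, hypTerm, poch_succ, poch_succ, show n + 1 + j = n + j + 1 by ring,
    Nat.factorial_succ, Nat.factorial_succ]
  push_cast
  field_simp
  ring

lemma poch_mul_poch_eq_euler_prod (s : ℝ) (n : ℕ) :
    poch (1 - s) n * poch (s + 1) n =
      n.factorial ^ 2 * ∏ k ∈ range n, (1 - s ^ 2 / ((k : ℝ) + 1) ^ 2) := by
  induction n with
  | zero => simp [poch_zero]
  | succ n ih =>
    rw [poch_succ, poch_succ, prod_range_succ, Nat.factorial_succ]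
    calc _ = poch (1 - s) n * poch (s + 1) n * ((1 - s + n) * (s + 1 + n)) := by ring
      _ = _ := by
        rw [ih]
        push_cast
        field_simp
        ring

lemma poch_neg_mul_poch_succ (s : ℝ) (n : ℕ) :
    poch (-s) (n + 1) * poch (s + 1) (n + 1) =
      -s * (s + 1 + n) * n.factorial ^ 2 * ∏ k ∈ range n, (1 - s ^ 2 / ((k : ℝ) + 1) ^ 2) := by
  rw [poch_succ_left, poch_succ (s + 1), show -s + 1 = 1 - s by ring]
  linear_combination (-s * (s + 1 + n)) * poch_mul_poch_eq_euler_prod s n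

lemma tendsto_euler_prod {s : ℝ} (hs : 0 < s) :
    Tendsto (fun n : ℕ => ∏ k ∈ range n, (1 - s ^ 2 / ((k : ℝ) + 1) ^ 2)) atTop
      (𝓝 (Real.sin (Real.pi * s) / (Real.pi * s))) := by
  have h : Real.pi * s ≠ 0 := by positivity
  refine ((Real.tendsto_euler_sin_prod s).div_const (Real.pi * s)).congr fun n => ?_
  rw [mul_div_cancel_left₀ _ h]

lemma exists_abs_poch_neg_mul_poch_le {s : ℝ} (hs : 0 < s) :
    ∃ C : ℝ, 0 ≤ C ∧ ∀ n : ℕ,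
      |poch (-s) n * poch (s + 1) n| ≤ C / (n + 1) * n.factorial ^ 2 := by
  obtain ⟨M, hM⟩ := isBounded_iff_forall_norm_le.1
    (Metric.isBounded_range_of_tendsto _ (tendsto_euler_prod hs))
  have hM' (n : ℕ) : |∏ k ∈ range n, (1 - s ^ 2 / ((k : ℝ) + 1) ^ 2)| ≤ M :=
    hM _ ⟨n, rfl⟩
  have hM0 : 0 ≤ M := (abs_nonneg _).trans (hM' 0)
  refine ⟨1 + 2 * s * (s + 1) * M, by positivity, fun n => ?_⟩
  cases n with
  | zero =>
    have : 0 ≤ 2 * s * (s + 1) * M := by positivity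
    simpa [poch_zero] using this
  | succ n =>
    rw [poch_neg_mul_poch_succ, abs_mul, Nat.factorial_succ]
    have h : |-s * (s + 1 + n) * (n.factorial : ℝ) ^ 2| = s * (s + 1 + n) * n.factorial ^ 2 := by
      rw [neg_mul, neg_mul, abs_neg, abs_of_nonneg (by positivity)]
    rw [h]
    refine (mul_le_mul_of_nonneg_left (hM' n) (by positivity)).trans ?_
    push_cast
    rw [div_mul_eq_mul_div, le_div_iff₀ (by positivity)]
    have key : s * (s + 1 + n) * M * (n + 1 + 1)
        ≤ (1 + 2 * s * (s + 1) * M) * ((n : ℝ) + 1) ^ 2 := by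
      have h1 : s + 1 + n ≤ (s + 1) * ((n : ℝ) + 1) := by
        nlinarith [mul_nonneg hs.le (Nat.cast_nonneg (α := ℝ) n)]
      have h2 : (n : ℝ) + 1 + 1 ≤ 2 * (n + 1) := by linarith [Nat.cast_nonneg (α := ℝ) n]
      have h3 : (s + 1 + n) * ((n : ℝ) + 1 + 1) ≤ (s + 1) * ((n : ℝ) + 1) * (2 * (n + 1)) :=
        mul_le_mul h1 h2 (by positivity) (by positivity)
      nlinarith [mul_le_mul_of_nonneg_left h3 (mul_nonneg hs.le hM0), sq_nonneg ((n : ℝ) + 1)]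
    nlinarith [mul_le_mul_of_nonneg_right key (sq_nonneg (n.factorial : ℝ))]

lemma exists_abs_hypTerm_le {s : ℝ} (hs : 0 < s) :
    ∃ C : ℝ, 0 ≤ C ∧ ∀ m n : ℕ,
      |hypTerm s (m + 1) n| ≤ C * (1 / m.factorial) * (1 / ((n : ℝ) + 1) ^ 2) := by
  obtain ⟨C, hC0, hC⟩ := exists_abs_poch_neg_mul_poch_le hs
  refine ⟨C, hC0, fun m n => ?_⟩
  have hfac : ((n : ℝ) + 1) * n.factorial * m.factorial ≤ (n + (m + 1)).factorial := by
    have := Nat.le_of_dvd (Nat.factorial_pos _)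
      (Nat.factorial_mul_factorial_dvd_factorial_add (n + 1) m)
    rw [show n + 1 + m = n + (m + 1) by ring, Nat.factorial_succ] at this
    exact_mod_cast this
  rw [hypTerm, abs_div, abs_of_pos (a := (n.factorial * (n + (m + 1)).factorial : ℝ))
    (by positivity)]
  calc _ ≤ C / (n + 1) * n.factorial ^ 2 /
        (n.factorial * (((n : ℝ) + 1) * n.factorial * m.factorial)) := by
        gcongr
        exact hC n
    _ = _ := by field_simp

lemma summable_one_div_nat_add_one_sq : Summable fun n : ℕ => 1 / ((n : ℝ) + 1) ^ 2 := by
  have := (summable_nat_add_iff 1).2 (Real.summable_one_div_nat_pow.2 one_lt_two)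
  simpa using this

lemma summable_hypTerm {s : ℝ} (hs : 0 < s) (m : ℕ) : Summable (hypTerm s (m + 1)) := by
  obtain ⟨C, -, hC⟩ := exists_abs_hypTerm_le hs
  exact .of_norm_bounded (summable_one_div_nat_add_one_sq.mul_left (C * (1 / m.factorial))) (hC m)

lemma sum_range_hypTerm_one {s : ℝ} (hs : 0 < s) (n : ℕ) :
    ∑ k ∈ range (n + 1), hypTerm s 1 k =
      (∏ k ∈ range n, (1 - s ^ 2 / ((k : ℝ) + 1) ^ 2)) * ((1 + s / (n + 1)) / (s + 1)) := by
  induction n with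
  | zero =>
    have : s + 1 ≠ 0 := by positivity
    simp [hypTerm, poch_zero]
    field_simp
    ring
  | succ n ih =>
    rw [sum_range_succ, ih, prod_range_succ, hypTerm, poch_neg_mul_poch_succ,
      Nat.factorial_succ (n + 1), Nat.factorial_succ n]
    push_cast
    have : s + 1 ≠ 0 := by positivity
    field_simp
    ring

lemma tsum_hypTerm_one {s : ℝ} (hs : 0 < s) :
    ∑' n, hypTerm s 1 n = Real.sin (Real.pi * s) / (Real.pi * s) / (s + 1) := by
  refine tendsto_nhds_unique
    ((tendsto_add_atTop_iff_nat 1).2 (summable_hypTerm hs 0).tendsto_sum_tsum_nat) ?_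
  simp only [zero_add, sum_range_hypTerm_one hs]
  have h : Tendsto (fun n : ℕ => s / ((n : ℝ) + 1)) atTop (𝓝 0) := by
    simpa [div_eq_mul_inv] using tendsto_one_div_add_atTop_nhds_zero_nat.const_mul s
  have := (tendsto_euler_prod hs).mul ((h.const_add 1).div_const (s + 1))
  simpa [div_eq_mul_inv] using this

lemma tsum_hypTerm_succ {s : ℝ} (hs : 0 < s) (m : ℕ) :
    ((m : ℝ) + 1) * ∑' n, hypTerm s (m + 1) n =
      ((m : ℝ) + 2 + s) * (m + 1 - s) * ∑' n, hypTerm s (m + 2) n := by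
  have h1 := (summable_hypTerm hs m).hasSum.mul_left ((m : ℝ) + 1)
  have h2 := (summable_hypTerm hs (m + 1)).hasSum.mul_left (((m : ℝ) + 2 + s) * (m + 1 - s))
  have h := (h1.sub h2).tendsto_sum_nat
  have htel (N : ℕ) : ∑ n ∈ range N, (((m : ℝ) + 1) * hypTerm s (m + 1) n -
      ((m : ℝ) + 2 + s) * (m + 1 - s) * hypTerm s (m + 1 + 1) n) =
        -(N * hypTerm s (m + 1) N) := by
    induction N with
    | zero => simp
    | succ N ih =>
      rw [sum_range_succ, ih, hypTerm_succ_left s (m + 1), hypTerm_succ_right]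
      have : (N : ℝ) + (m + 1) + 1 ≠ 0 := by positivity
      push_cast
      field_simp
      ring
  simp only [htel] at h
  have hlim : Tendsto (fun N : ℕ => -((N : ℝ) * hypTerm s (m + 1) N)) atTop (𝓝 0) := by
    obtain ⟨C, hC0, hC⟩ := exists_abs_hypTerm_le hs
    have hbound := (tendsto_one_div_add_atTop_nhds_zero_nat (𝕜 := ℝ)).const_mul
      (C * (1 / (m.factorial : ℝ)))
    rw [mul_zero] at hbound
    refine squeeze_zero_norm (fun N => ?_) hbound
    rw [norm_neg, Real.norm_eq_abs, abs_mul, Nat.abs_cast]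
    calc (N : ℝ) * |hypTerm s (m + 1) N|
        ≤ (N + 1) * (C * (1 / m.factorial) * (1 / ((N : ℝ) + 1) ^ 2)) := by
          gcongr
          · linarith
          · exact hC m N
      _ = _ := by field_simp
  exact sub_eq_zero.1 (tendsto_nhds_unique h hlim)

lemma gbinom_mul_tsum_hypTerm {s : ℝ} (hs : 0 < s) (hni : ∀ m : ℕ, s ≠ m) (m : ℕ) :
    gbinom (s - 1) m * ∑' n, hypTerm s (m + 1) n =
      (-1) ^ m / poch (s + 2) m * (Real.sin (Real.pi * s) / (Real.pi * s) / (s + 1)) := by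
  induction m with
  | zero => simp [gbinom, poch_zero, tsum_hypTerm_one hs]
  | succ m ih =>
    have hrec := tsum_hypTerm_succ hs m
    have hne : (m : ℝ) + 1 - s ≠ 0 := fun h =>
      hni (m + 1) (by push_cast; linarith)
    have hpos : (m : ℝ) + 2 + s ≠ 0 := by positivity
    have hp := (poch_pos (x := s + 2) (by positivity) m).ne'
    have hS : ∑' n, hypTerm s (m + 2) n =
        ((m : ℝ) + 1) * (∑' n, hypTerm s (m + 1) n) / (((m : ℝ) + 2 + s) * (m + 1 - s)) := by
      rw [hrec]
      field_simp
    calc _ = -(gbinom (s - 1) m * ∑' n, hypTerm s (m + 1) n) / (m + 2 + s) := by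
          rw [gbinom_succ, show m + 1 + 1 = m + 2 from rfl, hS]
          field_simp
          ring
      _ = _ := by
          have : s + 2 + (m : ℝ) ≠ 0 := by positivity
          rw [ih, poch_succ, pow_succ, show (m : ℝ) + 2 + s = s + 2 + m by ring]
          generalize Real.sin (Real.pi * s) / (Real.pi * s) / (s + 1) = A
          field_simp

lemma aCoef_succ_eq_sum_antidiagonal (α x : ℝ) (i : ℕ) :
    aCoef α (i + 1) x = ∑ p ∈ antidiagonal i,
      -x ^ (p.1 + 1) * gbinom (α + 1) p.1 * hypTerm (α + 2) (p.1 + 1) p.2 := by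
  rw [aCoef, Nat.sum_antidiagonal_eq_sum_range_succ_mk, mul_sum,
    ← Finset.Ico_add_one_right_eq_Icc, sum_Ico_eq_sum_range]
  refine sum_congr rfl fun m hm => ?_
  obtain ⟨n, rfl⟩ := Nat.exists_eq_add_of_le (Nat.lt_succ_iff.1 (mem_range.1 hm))
  rw [show 1 + m - 1 = m by omega, show m + n + 1 - (1 + m) = n by omega,
    show m + n - m = n by omega, gbinom_eq_poch_neg (α + 2), hypTerm,
    show n + (m + 1) = m + n + 1 by ring, show m + n + 1 + (1 + m) + 1 = 2 * (m + 1) + n + 1 by ring,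
    pow_succ, pow_add, pow_mul, show α + 2 + 1 = α + 3 by ring]
  have h : ((-1 : ℝ) ^ n) * (-1) ^ n = 1 := by rw [← mul_pow]; simp
  field_simp
  simp only [one_pow, add_comm 1 m]
  linear_combination (-gbinom (α + 1) m * poch (-(α + 2)) n * poch (α + 3) n * x ^ (m + 1)) * h

lemma summable_gbinom_mul_hypTerm {s : ℝ} (hs : 0 < s) (y x : ℝ) :
    Summable fun p : ℕ × ℕ => -x ^ (p.1 + 1) * gbinom y p.1 * hypTerm s (p.1 + 1) p.2 := by
  obtain ⟨C, hC0, hC⟩ := exists_abs_hypTerm_le hs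
  have hsum : Summable fun p : ℕ × ℕ => |x| * C *
      ((|x| * (|y| + 1)) ^ p.1 / p.1.factorial * (1 / ((p.2 : ℝ) + 1) ^ 2)) :=
    ((Real.summable_pow_div_factorial _).mul_of_nonneg summable_one_div_nat_add_one_sq
      (fun n => by positivity) (fun n => by positivity)).mul_left _
  refine .of_norm_bounded hsum fun ⟨m, n⟩ => ?_
  simp only [Real.norm_eq_abs, abs_mul, abs_neg, abs_pow]
  calc _ ≤ |x| ^ (m + 1) * (|y| + 1) ^ m *
        (C * (1 / m.factorial) * (1 / ((n : ℝ) + 1) ^ 2)) := by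
        gcongr
        · exact abs_gbinom_le y m
        · exact hC m n
    _ = _ := by
        rw [mul_pow]
        ring

lemma hasSum_sum_antidiagonal {f : ℕ × ℕ → ℝ} (hf : Summable f) :
    HasSum (fun i => ∑ p ∈ antidiagonal i, f p) (∑' p, f p) := by
  have h := (HasAntidiagonal.sigmaAntidiagonalEquivProd.hasSum_iff (f := f)).2 hf.hasSum
  refine h.sigma fun i => ?_
  convert hasSum_fintype _ using 1
  exact (sum_coe_sort (antidiagonal i) f).symm

end

theorem aCoef_sum_generic_alpha (α : ℝ) (hα : -1 < α) (hni : ∀ m : ℕ, α ≠ m) (x : ℝ) :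
    Summable (fun i : ℕ => aCoef α (i + 1) x) ∧
    ∑' i : ℕ, aCoef α (i + 1) x
      = -(Real.sin (Real.pi * α) / Real.pi) * (x / ((α + 2) * (α + 3))) *
          ∑' k : ℕ, poch 1 k / poch (α + 4) k * (-x) ^ k / k.factorial := by
  have hs : 0 < α + 2 := by linarith
  have hs_ne (m : ℕ) : α + 2 ≠ m := by
    intro h
    match m with
    | 0 => norm_num at h; linarith
    | 1 => norm_num at h; linarith
    | m + 2 => exact hni m (by push_cast at h; linarith)
  have hf := summable_gbinom_mul_hypTerm hs (α + 1) x
  have hsum := hasSum_sum_antidiagonal hf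
  simp only [← aCoef_succ_eq_sum_antidiagonal] at hsum
  refine ⟨hsum.summable, ?_⟩
  rw [hsum.tsum_eq, hf.tsum_prod, ← tsum_mul_left]
  refine tsum_congr fun m => ?_
  have hsin : Real.sin (Real.pi * (α + 2)) = Real.sin (Real.pi * α) := by
    rw [mul_add, mul_comm Real.pi 2, Real.sin_add_two_pi]
  have key := gbinom_mul_tsum_hypTerm hs hs_ne m
  rw [show α + 2 - 1 = α + 1 by ring, show α + 2 + 2 = α + 4 by ring,
    show α + 2 + 1 = α + 3 by ring, hsin] at key
  dsimp only
  rw [tsum_mul_left, mul_assoc, key, poch_one, neg_pow x]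
  have h3 : α + 3 ≠ 0 := by linarith
  have hp := (poch_pos (x := α + 4) (by linarith) m).ne'
  field_simp
  ring
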